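/- There is no birational surjective rational parametrization of the hyperboloid. Precisely: there do not exist polynomials p₁, p₂, p₃, q₁, q₂, q₃ ∈ ℂ[s,t] with each qᵢ ≠ 0 and gcd(pᵢ, qᵢ) = 1, and a nonzero polynomial h ∈ ℂ[s,t], such that, setting U = {(s,t) ∈ ℂ² : q₁(s,t)·q₂(s,t)·q₃(s,t) ≠ 0} and f(s,t) = (p₁(s,t)/q₁(s,t), p₂(s,t)/q₂(s,t), p₃(s,t)/q₃(s,t)) for (s,t) ∈ U, one has both (i) f(U) = S, where S = {(x,y,z) ∈ ℂ³ : x² + y² − z² = 1}, and (ii) f is injective on {(s,t) ∈ U : h(s,t) ≠ 0}. -/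

import Mathlib

open MvPolynomial

/-- Rational functions that separate generic points generate the function field. -/
theorem adjoin_range_div_eq_top {σ ι K : Type*} [Finite σ] [Field K] [Algebra ℂ K]
    [Algebra (MvPolynomial σ ℂ) K] [IsScalarTower ℂ (MvPolynomial σ ℂ) K]
    [IsFractionRing (MvPolynomial σ ℂ) K] (P : ι → MvPolynomial σ ℂ)
    (B G : MvPolynomial σ ℂ) (hG : G ≠ 0)
    (hinj : ∀ a b : σ → ℂ, eval a G ≠ 0 → eval b G ≠ 0 →
      (∀ i, eval a (P i) * eval b B = eval b (P i) * eval a B) → a = b) :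
    IntermediateField.adjoin ℂ
      (Set.range fun i ↦ (algebraMap _ K (P i) / algebraMap _ K B)) = ⊤ := by
  set F := IntermediateField.adjoin ℂ (Set.range fun i ↦
      (algebraMap _ K (P i) / algebraMap _ K B)) with hF
  have hinjK : Function.Injective (algebraMap (MvPolynomial σ ℂ) K) :=
    IsFractionRing.injective _ K
  have hne {p : MvPolynomial σ ℂ} (hp : p ≠ 0) : algebraMap _ K p ≠ 0 :=
    (map_ne_zero_iff _ hinjK).2 hp
  have hsub : Subsingleton (Field.Emb F K) := by
    refine ⟨fun f g ↦ ?_⟩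
    let Ω := AlgebraicClosure K
    let f' : MvPolynomial σ ℂ →ₐ[ℂ] Ω :=
      (f.restrictScalars ℂ).comp (IsScalarTower.toAlgHom ℂ (MvPolynomial σ ℂ) K)
    let g' : MvPolynomial σ ℂ →ₐ[ℂ] Ω :=
      (g.restrictScalars ℂ).comp (IsScalarTower.toAlgHom ℂ (MvPolynomial σ ℂ) K)
    have hf' (p) : f' p = f (algebraMap _ K p) := rfl
    have hg' (p) : g' p = g (algebraMap _ K p) := rfl
    let ψ : MvPolynomial (σ ⊕ σ) ℂ →ₐ[ℂ] Ω :=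
      aeval (Sum.elim (fun j ↦ f' (X j)) (fun j ↦ g' (X j)))
    have hl (p) : ψ (rename Sum.inl p) = f' p := by
      have : ψ.comp (rename Sum.inl) = f' := by ext; simp [ψ]
      exact DFunLike.congr_fun this p
    have hr (p) : ψ (rename Sum.inr p) = g' p := by
      have : ψ.comp (rename Sum.inr) = g' := by ext; simp [ψ]
      exact DFunLike.congr_fun this p
    have hX (j) : f' (X j) = g' (X j) := by
      by_contra hj
      have hW : rename Sum.inl G * rename Sum.inr G * (X (Sum.inl j) - X (Sum.inr j)) ∉
          RingHom.ker ψ := by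
        rw [RingHom.mem_ker, map_mul, map_mul, hl, hr, map_sub, hf', hg']
        refine mul_ne_zero (mul_ne_zero ?_ ?_) ?_
        · exact (map_ne_zero f).2 (hne hG)
        · exact (map_ne_zero g).2 (hne hG)
        · simpa [ψ, sub_eq_zero] using hj
      have : (RingHom.ker ψ).IsPrime := RingHom.ker_isPrime _
      rw [← IsPrime.vanishingIdeal_zeroLocus (K := ℂ) (RingHom.ker ψ),
        mem_vanishingIdeal_iff] at hW
      push Not at hW
      obtain ⟨x, hx, hxW⟩ := hW
      rw [mem_zeroLocus_iff] at hx
      simp only [map_mul, map_sub, aeval_X, aeval_rename, mul_ne_zero_iff] at hxW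
      obtain ⟨⟨h1, h2⟩, h3⟩ := hxW
      apply h3
      have := hinj (x ∘ Sum.inl) (x ∘ Sum.inr) h1 h2 ?_
      · simpa [sub_eq_zero] using congr_fun this j
      intro i
      have key := hx (rename Sum.inl (P i) * rename Sum.inr B -
        rename Sum.inr (P i) * rename Sum.inl B) ?_
      · simpa only [map_sub, map_mul, aeval_rename, sub_eq_zero, aeval_eq_eval] using key
      rw [RingHom.mem_ker, map_sub, map_mul, map_mul, hl, hl, hr, hr]
      by_cases hB : B = 0
      · simp [hB]
      have hm : algebraMap _ K (P i) / algebraMap _ K B ∈ F :=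
        IntermediateField.subset_adjoin _ _ ⟨i, rfl⟩
      have e1 := f.commutes ⟨_, hm⟩
      have e2 := g.commutes ⟨_, hm⟩
      have e3 : f (algebraMap _ K (P i) / algebraMap _ K B) =
        g (algebraMap _ K (P i) / algebraMap _ K B) := e1.trans e2.symm
      rw [map_div₀, map_div₀, div_eq_div_iff ((map_ne_zero f).2 (hne hB))
          ((map_ne_zero g).2 (hne hB))] at e3
      simp only [hf', hg', e3]
      ring
    have hfg : f' = g' := by ext j; exact hX j
    have : (f : K →+* Ω) = g := by
      apply IsLocalization.ringHom_ext (nonZeroDivisors (MvPolynomial σ ℂ))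
      exact congr_arg (fun k : MvPolynomial σ ℂ →ₐ[ℂ] Ω ↦ (k : MvPolynomial σ ℂ →+* Ω)) hfg
    ext x
    exact DFunLike.congr_fun this x
  have h1 : Field.finSepDegree F K = 1 := Nat.card_unique
  have := isPurelyInseparable_of_finSepDegree_eq_one h1
  have := IsPurelyInseparable.surjective_algebraMap_of_isSeparable F K
  refine eq_top_iff.2 fun x _ ↦ ?_
  obtain ⟨y, rfl⟩ := this x
  exact y.2

/-- Substituting fractions with a common denominator `B` into a polynomial gives a polynomial,
up to a power of `B`, uniformly in all evaluations that do not kill `B`. -/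
theorem exists_clear_denominators.{w} {σ ι k : Type*} [Field k] (P : ι → MvPolynomial σ k)
    (B : MvPolynomial σ k) (N : MvPolynomial ι k) :
    ∃ (n : ℕ) (H : MvPolynomial σ k), ∀ (L : Type w) [Field L] [Algebra k L]
      (φ : MvPolynomial σ k →ₐ[k] L), φ B ≠ 0 →
        φ H = φ B ^ n * aeval (fun i ↦ φ (P i) / φ B) N := by
  induction N using MvPolynomial.induction_on with
  | C a => exact ⟨0, C a, fun L _ _ φ _ ↦ by simp [← algebraMap_eq]⟩
  | add p q hp hq =>
    obtain ⟨n, H, h⟩ := hp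
    obtain ⟨m, J, h'⟩ := hq
    refine ⟨n + m, B ^ m * H + B ^ n * J, fun L _ _ φ hB ↦ ?_⟩
    simp only [map_add, map_mul, map_pow, h L φ hB, h' L φ hB]
    ring
  | mul_X p i hp =>
    obtain ⟨n, H, h⟩ := hp
    refine ⟨n + 1, H * P i, fun L _ _ φ hB ↦ ?_⟩
    simp only [map_mul, h L φ hB, aeval_X]
    field_simp
    ring

theorem prime_one_sub_X_mul_X : Prime (1 - X 0 * X 1 : MvPolynomial (Fin 2) ℂ) := by
  have := irreducible_mul_X_add (-X 0 : MvPolynomial (Fin 2) ℂ) 1 1 (by simp)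
    (by simp) (by simp) (isRelPrime_one_right)
  rw [← irreducible_iff_prime]
  rwa [show (1 - X 0 * X 1 : MvPolynomial (Fin 2) ℂ) = -X 0 * X 1 + 1 by ring]

/-- If `N` and `M` are coprime and every zero of `N` outside the prime divisor `E` is a zero
of `M`, then `N` is a power of `E` up to a unit. -/
theorem exists_associated_pow_of_zeros {σ : Type*} [Finite σ] {M N E : MvPolynomial σ ℂ}
    (hE : Prime E) (hMN : IsRelPrime N M)
    (h : ∀ x, eval x E ≠ 0 → eval x N = 0 → eval x M = 0) :
    ∃ n, Associated N (E ^ n) := by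
  have : M * E ∈ vanishingIdeal ℂ (zeroLocus ℂ (Ideal.span {N})) := by
    simp only [zeroLocus_span, mem_vanishingIdeal_iff, Set.mem_ofPred_eq, Set.mem_singleton_iff,
      forall_eq, map_mul, mul_eq_zero]
    exact fun x hx ↦ (em _).symm.imp_left fun hx' ↦ h x hx' hx
  rw [vanishingIdeal_zeroLocus_eq_radical] at this
  obtain ⟨n, hn⟩ := this
  rw [Ideal.mem_span_singleton, mul_pow] at hn
  obtain ⟨i, -, hi⟩ := (dvd_prime_pow hE n).1 ((hMN.pow_right).dvd_of_dvd_mul_left hn)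
  exact ⟨i, hi⟩

/-- A parametrization of the hyperboloid `x² + y² - z² = 1` by fractions with a common denominator
cannot be both surjective and generically injective. -/
theorem hyperboloid_parametrization_absurd (P₁ P₂ P₃ Q h : MvPolynomial (Fin 2) ℂ)
    (hQ : Q ≠ 0) (hh : h ≠ 0)
    (hmap : ∀ a, eval a Q ≠ 0 →
      eval a P₁ ^ 2 + eval a P₂ ^ 2 - eval a P₃ ^ 2 = eval a Q ^ 2)
    (hsurj : ∀ x y z : ℂ, x ^ 2 + y ^ 2 - z ^ 2 = 1 → ∃ a, eval a Q ≠ 0 ∧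
      eval a P₁ = x * eval a Q ∧ eval a P₂ = y * eval a Q ∧ eval a P₃ = z * eval a Q)
    (hinj : ∀ a b, eval a Q ≠ 0 → eval b Q ≠ 0 → eval a h ≠ 0 → eval b h ≠ 0 →
      eval a P₁ * eval b Q = eval b P₁ * eval a Q →
      eval a P₂ * eval b Q = eval b P₂ * eval a Q →
      eval a P₃ * eval b Q = eval b P₃ * eval a Q → a = b) : False := by
  obtain ⟨B, hBdef⟩ : ∃ B, B = P₁ + Q := ⟨_, rfl⟩
  obtain ⟨C', hCdef⟩ : ∃ C', C' = P₃ - P₂ := ⟨_, rfl⟩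
  obtain ⟨D, hDdef⟩ : ∃ D, D = P₃ + P₂ := ⟨_, rfl⟩
  have hB : B ≠ 0 := by
    rintro rfl
    obtain ⟨a, ha, h1, -⟩ := hsurj 1 0 0 (by norm_num)
    have := congr_arg (eval a) hBdef
    simp only [map_zero, map_add, h1] at this
    exact ha (by linear_combination -this / 2)
  have hquad : (B - 2 * Q) * B = C' * D := by
    apply mul_left_cancel₀ hQ
    refine MvPolynomial.funext fun a ↦ ?_
    simp only [map_mul, map_sub, map_ofNat, hBdef, hCdef, hDdef, map_add]
    by_cases ha : eval a Q = 0
    · simp [ha]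
    · linear_combination eval a Q * hmap a ha
  have hquad' (a) : (eval a B - 2 * eval a Q) * eval a B = eval a C' * eval a D := by
    simpa only [map_mul, map_sub, map_ofNat] using congr_arg (eval a) hquad
  have eB (a) : eval a B = eval a P₁ + eval a Q := by rw [hBdef, map_add]
  have eC (a) : eval a C' = eval a P₃ - eval a P₂ := by rw [hCdef, map_sub]
  have eD (a) : eval a D = eval a P₃ + eval a P₂ := by rw [hDdef, map_add]
  obtain ⟨γ, β, δ, hγβ, hδγ, hδβ⟩ := UniqueFactorizationMonoid.exists_reduced_factors B hB D
  have hδ : δ ≠ 0 := by rintro rfl; exact hB (by rw [← hδγ, zero_mul])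
  obtain ⟨α, hα⟩ : γ ∣ C' := by
    refine hγβ.dvd_of_dvd_mul_right ⟨B - 2 * Q, mul_left_cancel₀ hδ ?_⟩
    linear_combination -hquad + C' * hδβ - (B - 2 * Q) * hδγ
  let K := FractionRing (MvPolynomial (Fin 2) ℂ)
  have htop := adjoin_range_div_eq_top (K := K) ![C', D] B (Q * B * h)
    (mul_ne_zero (mul_ne_zero hQ hB) hh) (by
      intro a b ha hb hab
      have h0 := hab 0
      have h1 := hab 1
      simp only [Matrix.cons_val_zero, Matrix.cons_val_one] at h0 h1
      simp only [map_mul, mul_ne_zero_iff] at ha hb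
      obtain ⟨⟨ha1, ha2⟩, ha3⟩ := ha
      obtain ⟨⟨hb1, hb2⟩, hb3⟩ := hb
      have hQab : eval a Q * eval b B = eval b Q * eval a B := by
        apply mul_left_cancel₀ (mul_ne_zero (mul_ne_zero two_ne_zero ha2) hb2)
        linear_combination (eval b B) ^ 2 * (-hquad' a) + (eval a B) ^ 2 * hquad' b
          - eval a D * eval b B * h0 - eval b C' * eval a B * h1
      have hcross {p q : ℂ} (hpq : p * eval b B = q * eval a B) :
          p * eval b Q = q * eval a Q := by
        apply mul_left_cancel₀ ha2
        linear_combination eval a Q * hpq - p * hQab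
      have hab0 := hcross h0
      have hab1 := hcross h1
      rw [eC, eC] at hab0
      rw [eD, eD] at hab1
      refine hinj a b ha1 hb1 ha3 hb3 ?_ ?_ ?_
      · apply hcross
        rw [eB, eB] at hQab ⊢
        linear_combination -hQab
      · linear_combination (hab1 - hab0) / 2
      · linear_combination (hab1 + hab0) / 2)
  have hmem : algebraMap _ K δ ∈ IntermediateField.adjoin ℂ
      (Set.range fun i ↦ (algebraMap _ K (![C', D] i) / algebraMap _ K B)) :=
    htop ▸ IntermediateField.mem_top
  rw [IntermediateField.mem_adjoin_range_iff] at hmem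
  obtain ⟨r, s, hrs⟩ := hmem
  set w : Fin 2 → K := fun i ↦ (algebraMap _ K (![C', D] i) / algebraMap _ K B) with hw
  have hne {p : MvPolynomial (Fin 2) ℂ} (hp : p ≠ 0) : algebraMap _ K p ≠ 0 :=
    (map_ne_zero_iff _ (IsFractionRing.injective _ K)).2 hp
  have hs' : aeval w s ≠ 0 := by
    intro h0
    rw [h0, div_zero] at hrs
    exact hne hδ hrs
  have hs : s ≠ 0 := by rintro rfl; simp at hs'
  obtain ⟨N, M, c, hNM, rfl, rfl⟩ := UniqueFactorizationMonoid.exists_reduced_factors s hs r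
  have hfrac : algebraMap _ K δ * aeval w N = aeval w M := by
    rw [map_mul, mul_ne_zero_iff] at hs'
    rw [hrs, map_mul, map_mul, mul_div_mul_left _ _ hs'.1, div_mul_cancel₀ _ hs'.2]
  obtain ⟨n, H, hH⟩ := exists_clear_denominators.{0} ![C', D] B N
  obtain ⟨m, J, hJ⟩ := exists_clear_denominators.{0} ![C', D] B M
  have hpoly : δ * H * B ^ m = J * B ^ n := by
    apply IsFractionRing.injective _ K
    have h1 := hH K (IsScalarTower.toAlgHom ℂ _ K) (hne hB)
    have h2 := hJ K (IsScalarTower.toAlgHom ℂ _ K) (hne hB)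
    simp only [IsScalarTower.coe_toAlgHom', ← hw] at h1 h2
    rw [map_mul, map_mul, map_mul, map_pow, map_pow, h1, h2, ← hfrac]
    ring
  have hpt (a) (ha : eval a B ≠ 0) :
      eval a δ * eval (fun i ↦ eval a (![C', D] i) / eval a B) N =
        eval (fun i ↦ eval a (![C', D] i) / eval a B) M := by
    have h1 := hH ℂ (aeval a) ha
    have h2 := hJ ℂ (aeval a) ha
    simp only [aeval_eq_eval] at h1 h2
    have h3 := congr_arg (eval a) hpoly
    rw [map_mul, map_mul, map_mul, map_pow, map_pow, h1, h2] at h3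
    apply mul_left_cancel₀ (pow_ne_zero (n + m) ha)
    linear_combination h3
  have hδa (a) (ha : eval a B ≠ 0) : eval a δ ≠ 0 := by
    intro h0
    rw [← hδγ, map_mul, h0, zero_mul] at ha
    exact ha rfl
  have hchart (x : Fin 2 → ℂ) (hx : eval x (1 - X 0 * X 1) ≠ 0) :
      ∃ a, eval a B ≠ 0 ∧ (fun i ↦ eval a (![C', D] i) / eval a B) = x := by
    simp only [map_sub, map_one, map_mul, eval_X] at hx
    obtain ⟨a, ha, h1, h2, h3⟩ := hsurj ((1 + x 0 * x 1) / (1 - x 0 * x 1))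
      ((x 1 - x 0) / (1 - x 0 * x 1)) ((x 1 + x 0) / (1 - x 0 * x 1)) (by field_simp; ring)
    have hBa : eval a B = 2 / (1 - x 0 * x 1) * eval a Q := by
      rw [eB, h1]; field_simp; ring
    have hBa' : eval a B ≠ 0 := by
      rw [hBa]
      exact mul_ne_zero (div_ne_zero two_ne_zero hx) ha
    refine ⟨a, hBa', funext fun i ↦ ?_⟩
    rw [div_eq_iff hBa']
    fin_cases i
    · change eval a C' = x 0 * eval a B
      rw [eC, h2, h3, hBa]
      ring
    · change eval a D = x 1 * eval a B
      rw [eD, h2, h3, hBa]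
      ring
  obtain ⟨i, hi⟩ := exists_associated_pow_of_zeros prime_one_sub_X_mul_X hNM fun x hx hN ↦ by
    obtain ⟨a, ha, rfl⟩ := hchart x hx
    rw [← hpt a ha, hN, mul_zero]
  obtain ⟨j, hj⟩ := exists_associated_pow_of_zeros prime_one_sub_X_mul_X hNM.symm fun x hx hM ↦ by
    obtain ⟨a, ha, rfl⟩ := hchart x hx
    rw [← hpt a ha] at hM
    exact (mul_eq_zero.1 hM).resolve_left (hδa a ha)
  have hij : i = 0 ∨ j = 0 := by
    by_contra! h0
    exact prime_one_sub_X_mul_X.not_isUnit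
      (hNM ((dvd_pow_self _ h0.1).trans hi.symm.dvd) ((dvd_pow_self _ h0.2).trans hj.symm.dvd))
  obtain ⟨⟨u, hu⟩, ⟨v, hv⟩⟩ := And.intro hi hj
  obtain ⟨c₁, hc₁, hu'⟩ := MvPolynomial.isUnit_iff_eq_C_of_isReduced.1 u.isUnit
  obtain ⟨c₂, hc₂, hv'⟩ := MvPolynomial.isUnit_iff_eq_C_of_isReduced.1 v.isUnit
  rw [hu'] at hu
  rw [hv'] at hv
  have hfinal : δ * C c₂ * (2 * Q) ^ i * B ^ j = C c₁ * (2 * Q) ^ j * B ^ i := by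
    apply mul_left_cancel₀ hB
    refine MvPolynomial.funext fun a ↦ ?_
    by_cases ha : eval a B = 0
    · simp [ha]
    have h1 := hpt a ha
    have hE : 2 * eval a Q = eval (fun i ↦ eval a (![C', D] i) / eval a B) (1 - X 0 * X 1) *
        eval a B := by
      simp only [map_sub, map_one, map_mul, eval_X, Matrix.cons_val_zero, Matrix.cons_val_one]
      field_simp
      linear_combination -hquad' a
    have h2 := congr_arg (eval fun i ↦ eval a (![C', D] i) / eval a B) hu
    have h3 := congr_arg (eval fun i ↦ eval a (![C', D] i) / eval a B) hv
    simp only [map_mul, map_pow, eval_C, map_ofNat] at h2 h3 ⊢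
    rw [hE, mul_pow, mul_pow, ← h2, ← h3]
    linear_combination eval a B ^ (i + j + 1) * c₁ * c₂ * h1
  have hfinal' (a) : eval a δ * c₂ * (2 * eval a Q) ^ i * eval a B ^ j =
      c₁ * (2 * eval a Q) ^ j * eval a B ^ i := by
    simpa only [map_mul, map_pow, eval_C, map_ofNat] using congr_arg (eval a) hfinal
  have hδγ' (a) : eval a δ * eval a γ = eval a B := by rw [← map_mul, hδγ]
  have hδβ' (a) : eval a δ * eval a β = eval a D := by rw [← map_mul, hδβ]
  have hα' (a) : eval a C' = eval a γ * eval a α := by rw [← map_mul, hα]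
  obtain ⟨a, ha, ha1, ha2, ha3⟩ := hsurj (-1) 1 1 (by norm_num)
  obtain ⟨b, hb, hb1, hb2, hb3⟩ := hsurj (-1) 1 (-1) (by norm_num)
  have hBa : eval a B = 0 := by rw [eB, ha1]; ring
  have hBb : eval b B = 0 := by rw [eB, hb1]; ring
  have hDa : eval a D ≠ 0 := by
    rw [eD, ha2, ha3, ← two_mul, one_mul]
    exact mul_ne_zero two_ne_zero ha
  have hCb : eval b C' ≠ 0 := by
    rw [eC, hb2, hb3, show -1 * eval b Q - 1 * eval b Q = -2 * eval b Q by ring]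
    exact mul_ne_zero (by norm_num) hb
  have hδa0 : eval a δ ≠ 0 := left_ne_zero_of_mul (hδβ' a ▸ hDa)
  have hδb0 : eval b δ = 0 := by
    have h0 := hδγ' b
    rw [hBb] at h0
    exact (mul_eq_zero.1 h0).resolve_right (left_ne_zero_of_mul (hα' b ▸ hCb))
  have hfa := hfinal' a
  have hfb := hfinal' b
  rw [hBa] at hfa
  rw [hδb0, hBb] at hfb
  have hQ2 (x : Fin 2 → ℂ) (hx : eval x Q ≠ 0) (n : ℕ) : (2 * eval x Q) ^ n ≠ 0 :=
    pow_ne_zero n (mul_ne_zero two_ne_zero hx)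
  rcases Nat.eq_zero_or_pos i with rfl | hi0
  · rw [zero_mul, zero_mul, zero_mul, pow_zero, mul_one, eq_comm] at hfb
    exact mul_ne_zero hc₁.ne_zero (hQ2 b hb j) hfb
  · obtain rfl : j = 0 := hij.resolve_left hi0.ne'
    rw [zero_pow hi0.ne', pow_zero, mul_one, mul_zero] at hfa
    exact mul_ne_zero (mul_ne_zero hδa0 hc₂.ne_zero) (hQ2 a ha i) hfa

/-- There is no birational surjective rational parametrization of the hyperboloid
`S = {(x,y,z) ∈ ℂ³ : x² + y² − z² = 1}`.  A rational map `ℂ² ⇢ ℂ³` is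
represented by polynomials `pᵢ, qᵢ ∈ ℂ[s,t]` with `qᵢ ≠ 0` and `gcd(pᵢ,qᵢ) = 1`
(formalized as `IsRelPrime (pᵢ) (qᵢ)`), defined on
`U = {(s,t) : q₁(s,t)·q₂(s,t)·q₃(s,t) ≠ 0}` by `f = (p₁/q₁, p₂/q₂, p₃/q₃)`;
birationality is expressed by injectivity on the nonempty Zariski-open subset
`{(s,t) ∈ U : h(s,t) ≠ 0}` for some nonzero `h ∈ ℂ[s,t]`. -/
theorem no_birational_surjective_parametrization_hyperboloid :
    ¬ ∃ (p₁ p₂ p₃ q₁ q₂ q₃ h : MvPolynomial (Fin 2) ℂ),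
      q₁ ≠ 0 ∧ q₂ ≠ 0 ∧ q₃ ≠ 0 ∧
      IsRelPrime p₁ q₁ ∧ IsRelPrime p₂ q₂ ∧ IsRelPrime p₃ q₃ ∧
      h ≠ 0 ∧
      (fun st : ℂ × ℂ =>
          (eval ![st.1, st.2] p₁ / eval ![st.1, st.2] q₁,
           eval ![st.1, st.2] p₂ / eval ![st.1, st.2] q₂,
           eval ![st.1, st.2] p₃ / eval ![st.1, st.2] q₃)) ''
        {st : ℂ × ℂ | eval ![st.1, st.2] (q₁ * q₂ * q₃) ≠ 0} =
        {xyz : ℂ × ℂ × ℂ | xyz.1 ^ 2 + xyz.2.1 ^ 2 - xyz.2.2 ^ 2 = 1} ∧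
      Set.InjOn
        (fun st : ℂ × ℂ =>
          (eval ![st.1, st.2] p₁ / eval ![st.1, st.2] q₁,
           eval ![st.1, st.2] p₂ / eval ![st.1, st.2] q₂,
           eval ![st.1, st.2] p₃ / eval ![st.1, st.2] q₃))
        {st : ℂ × ℂ | eval ![st.1, st.2] (q₁ * q₂ * q₃) ≠ 0 ∧
          eval ![st.1, st.2] h ≠ 0} := by
  rintro ⟨p₁, p₂, p₃, q₁, q₂, q₃, h, hq₁, hq₂, hq₃, -, -, -, hh, himg, hinj⟩
  have hvec (a : Fin 2 → ℂ) : ![a 0, a 1] = a := by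
    funext i
    fin_cases i <;> rfl
  refine hyperboloid_parametrization_absurd (p₁ * q₂ * q₃) (p₂ * q₁ * q₃) (p₃ * q₁ * q₂)
    (q₁ * q₂ * q₃) h (mul_ne_zero (mul_ne_zero hq₁ hq₂) hq₃) hh ?_ ?_ ?_
  · intro a ha
    have hmem := himg.subset ⟨(a 0, a 1), by simpa only [Set.mem_ofPred_eq, hvec] using ha, rfl⟩
    simp only [map_mul, mul_ne_zero_iff] at ha
    obtain ⟨⟨h1, h2⟩, h3⟩ := ha
    simp only [Set.mem_ofPred_eq, hvec] at hmem
    field_simp at hmem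
    simp only [map_mul]
    linear_combination hmem
  · intro x y z hxyz
    obtain ⟨⟨s, t⟩, hst, heq⟩ := himg.superset (show (x, y, z) ∈ _ from hxyz)
    refine ⟨![s, t], hst, ?_⟩
    simp only [Set.mem_ofPred_eq, map_mul, mul_ne_zero_iff] at hst
    obtain ⟨⟨h1, h2⟩, h3⟩ := hst
    simp only [Prod.mk.injEq] at heq
    obtain ⟨rfl, rfl, rfl⟩ := heq
    simp only [map_mul]
    refine ⟨?_, ?_, ?_⟩ <;> field_simp
  · intro a b ha hb hha hhb e1 e2 e3
    have := @hinj (a 0, a 1) (by simpa only [Set.mem_ofPred_eq, hvec] using ⟨ha, hha⟩)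
      (b 0, b 1) (by simpa only [Set.mem_ofPred_eq, hvec] using ⟨hb, hhb⟩) ?_
    · simp only [Prod.mk.injEq] at this
      rw [← hvec a, ← hvec b, this.1, this.2]
    · simp only [map_mul, mul_ne_zero_iff] at ha hb e1 e2 e3
      obtain ⟨⟨ha1, ha2⟩, ha3⟩ := ha
      obtain ⟨⟨hb1, hb2⟩, hb3⟩ := hb
      simp only [hvec, Prod.mk.injEq, div_eq_div_iff, ha1, ha2, ha3, hb1, hb2, hb3, ne_eq,
        not_false_eq_true]
      refine ⟨?_, ?_, ?_⟩
      · apply mul_left_cancel₀ (mul_ne_zero (mul_ne_zero ha2 ha3) (mul_ne_zero hb2 hb3))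
        linear_combination e1
      · apply mul_left_cancel₀ (mul_ne_zero (mul_ne_zero ha1 ha3) (mul_ne_zero hb1 hb3))
        linear_combination e2
      · apply mul_left_cancel₀ (mul_ne_zero (mul_ne_zero ha1 ha2) (mul_ne_zero hb1 hb2))
        linear_combination e3
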